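/- (Theorem 3, boundedness part) If g ∈ L_1(ℝ), then the index transform (Gg)(x) = √π ∫_{−∞}^∞ Re[J_{iτ}(√x)²] · g(τ)/cosh(πτ) dτ is well defined, bounded and continuous on (0,∞), and sup_{x>0} |(Gg)(x)| ≤ √π ∫_{−∞}^∞ |g(τ)| dτ. -/

import Mathlib

open Complex MeasureTheory Real Set

/-- Bessel function of the first kind, defined by its power series. -/
noncomputable def besselJ (ν z : ℂ) : ℂ :=
  ∑' k : ℕ, ((-1 : ℂ) ^ k * (z / 2) ^ (2 * (k : ℂ) + ν)) /
    ((k.factorial : ℂ) * Complex.Gamma ((k : ℂ) + ν + 1))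

/-- The index transform `(Gg)(x) = √π ∫_{−∞}^∞ Re[J_{iτ}(√x)²] g(τ)/cosh(πτ) dτ`. -/
noncomputable def indexG (g : ℝ → ℂ) (x : ℝ) : ℂ :=
  (Real.sqrt π : ℂ) * ∫ τ : ℝ,
    ((((besselJ (Complex.I * τ) (Real.sqrt x : ℂ)) ^ 2).re : ℝ) : ℂ) * g τ /
      ((Real.cosh (π * τ) : ℝ) : ℂ)

/-- The kernel of the Beta integral `B(1/2, ν + 1/2)`. -/
noncomputable def besselPoissonKernel (ν : ℂ) (s : ℝ) : ℂ :=
  (s : ℂ) ^ ((1 / 2 : ℂ) - 1) * (1 - (s : ℂ)) ^ (ν + 1 / 2 - 1)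

/-- The integral occurring in Poisson's representation of the Bessel function. -/
noncomputable def poissonIntegral (ν z : ℂ) : ℂ :=
  ∫ s in (0 : ℝ)..1, Complex.cos (z * (√s : ℝ)) * besselPoissonKernel ν s

theorem intervalIntegrable_besselPoissonKernel {ν : ℂ} (hν : -(1 / 2) < ν.re) :
    IntervalIntegrable (besselPoissonKernel ν) volume 0 1 :=
  Complex.betaIntegral_convergent (by norm_num) (by norm_num; linarith)

theorem factorial_mul_Gamma_add_half (k : ℕ) :
    (k.factorial : ℂ) * Complex.Gamma (k + 1 / 2) * 4 ^ k =
      (2 * k).factorial * Complex.Gamma (1 / 2) := by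
  induction k with
  | zero => simp
  | succ k ih =>
    have hk : (k : ℂ) + 1 / 2 ≠ 0 := fun h => by
      have := congrArg Complex.re h
      norm_num at this
      linarith [(Nat.cast_nonneg k : (0 : ℝ) ≤ k)]
    have hG : Complex.Gamma (((k + 1 : ℕ) : ℂ) + 1 / 2) =
        ((k : ℂ) + 1 / 2) * Complex.Gamma (k + 1 / 2) := by
      rw [← Complex.Gamma_add_one _ hk]
      congr 1
      push_cast
      ring
    rw [hG, show 2 * (k + 1) = 2 * k + 1 + 1 by ring, Nat.factorial_succ, Nat.factorial_succ,
      Nat.factorial_succ]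
    push_cast
    linear_combination ((k : ℂ) + 1) * (k + 1 / 2) * 4 * ih

theorem integral_pow_mul_besselPoissonKernel {ν : ℂ} (hν : -(1 / 2) < ν.re) (k : ℕ) :
    ∫ s in (0 : ℝ)..1, (s : ℂ) ^ k * besselPoissonKernel ν s =
      Complex.Gamma (k + 1 / 2) * Complex.Gamma (ν + 1 / 2) / Complex.Gamma (k + ν + 1) := by
  have hk : (0 : ℝ) ≤ k := Nat.cast_nonneg k
  have h1 : 0 < ((k : ℂ) + 1 / 2).re := by norm_num; linarith
  have h2 : 0 < (ν + 1 / 2).re := by norm_num; linarith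
  have h3 : 0 < ((k : ℂ) + ν + 1).re := by norm_num; linarith
  rw [Complex.Gamma_mul_Gamma_eq_betaIntegral h1 h2,
    show (k : ℂ) + 1 / 2 + (ν + 1 / 2) = k + ν + 1 by ring,
    mul_div_cancel_left₀ _ (Complex.Gamma_ne_zero_of_re_pos h3), Complex.betaIntegral]
  refine intervalIntegral.integral_congr_ae (Filter.Eventually.of_forall fun s hs => ?_)
  rw [uIoc_of_le zero_le_one] at hs
  have hs0 : (s : ℂ) ≠ 0 := Complex.ofReal_ne_zero.mpr hs.1.ne'
  rw [besselPoissonKernel, ← mul_assoc, show (k : ℂ) + 1 / 2 - 1 = k + (1 / 2 - 1) by ring,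
    Complex.cpow_add _ _ hs0, Complex.cpow_natCast]

theorem ofReal_sqrt_pow_two_mul {s : ℝ} (hs : 0 ≤ s) (k : ℕ) :
    ((√s : ℝ) : ℂ) ^ (2 * k) = (s : ℂ) ^ k := by
  rw [pow_mul, ← Complex.ofReal_pow, Real.sq_sqrt hs]

theorem hasSum_poissonIntegral {ν : ℂ} (hν : -(1 / 2) < ν.re) (z : ℂ) :
    HasSum (fun k : ℕ => (-1) ^ k * z ^ (2 * k) / ((2 * k).factorial : ℂ) *
      (Complex.Gamma (k + 1 / 2) * Complex.Gamma (ν + 1 / 2) / Complex.Gamma (k + ν + 1)))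
      (poissonIntegral ν z) := by
  have hK := intervalIntegrable_besselPoissonKernel hν
  have hsum (t : ℝ) : HasSum (fun k : ℕ => ‖z‖ ^ (2 * k) / ((2 * k).factorial : ℝ) *
      ‖besselPoissonKernel ν t‖) (Real.cosh ‖z‖ * ‖besselPoissonKernel ν t‖) :=
    (Real.hasSum_cosh ‖z‖).mul_right _
  have key := intervalIntegral.hasSum_integral_of_dominated_convergence (μ := volume)
    (a := 0) (b := 1)
    (F := fun (k : ℕ) (s : ℝ) => (-1) ^ k * z ^ (2 * k) / ((2 * k).factorial : ℂ) *
      ((s : ℂ) ^ k * besselPoissonKernel ν s))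
    (f := fun s : ℝ => Complex.cos (z * (√s : ℝ)) * besselPoissonKernel ν s)
    (fun k t => ‖z‖ ^ (2 * k) / ((2 * k).factorial : ℝ) * ‖besselPoissonKernel ν t‖) ?_ ?_ ?_ ?_ ?_
  · simp only [intervalIntegral.integral_const_mul,
      integral_pow_mul_besselPoissonKernel hν] at key
    exact key
  · intro k
    have : Continuous fun s : ℝ => (s : ℂ) ^ k := by fun_prop
    exact ((this.aestronglyMeasurable).mul hK.aestronglyMeasurable_restrict_uIoc).const_mul _
  · refine fun k => Filter.Eventually.of_forall fun t ht => ?_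
    rw [uIoc_of_le zero_le_one] at ht
    simp only [norm_mul, norm_div, norm_pow, norm_neg, norm_one, one_pow, one_mul,
      Complex.norm_natCast, Complex.norm_real, Real.norm_eq_abs, abs_of_pos ht.1]
    gcongr
    exact mul_le_of_le_one_left (norm_nonneg _) (pow_le_one₀ ht.1.le ht.2)
  · exact Filter.Eventually.of_forall fun t _ => (hsum t).summable
  · simp only [(hsum _).tsum_eq]
    exact hK.norm.const_mul _
  · refine Filter.Eventually.of_forall fun t ht => ?_
    rw [uIoc_of_le zero_le_one] at ht
    refine ((Complex.hasSum_cos (z * (√t : ℝ))).mul_right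
      (besselPoissonKernel ν t)).congr_fun fun k => ?_
    rw [mul_pow, ofReal_sqrt_pow_two_mul ht.1.le]
    ring

theorem hasSum_besselJ {ν z : ℂ} (hν : -(1 / 2) < ν.re) (hz : z ≠ 0) :
    HasSum (fun k : ℕ => ((-1 : ℂ) ^ k * (z / 2) ^ (2 * (k : ℂ) + ν)) /
      ((k.factorial : ℂ) * Complex.Gamma ((k : ℂ) + ν + 1)))
      ((z / 2) ^ ν / (Complex.Gamma (1 / 2) * Complex.Gamma (ν + 1 / 2)) *
        poissonIntegral ν z) := by
  have h2 : Complex.Gamma (ν + 1 / 2) ≠ 0 :=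
    Complex.Gamma_ne_zero_of_re_pos (by norm_num; linarith)
  have h1 : Complex.Gamma (1 / 2) ≠ 0 := Complex.Gamma_ne_zero_of_re_pos (by norm_num)
  refine ((hasSum_poissonIntegral hν z).mul_left
    ((z / 2) ^ ν / (Complex.Gamma (1 / 2) * Complex.Gamma (ν + 1 / 2)))).congr_fun fun k => ?_
  have hk : (0 : ℝ) ≤ k := Nat.cast_nonneg k
  have h3 : Complex.Gamma ((k : ℂ) + ν + 1) ≠ 0 :=
    Complex.Gamma_ne_zero_of_re_pos (by norm_num; linarith)
  have h4 : (k.factorial : ℂ) ≠ 0 := Nat.cast_ne_zero.mpr k.factorial_ne_zero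
  have h5 : ((2 * k).factorial : ℂ) ≠ 0 := Nat.cast_ne_zero.mpr (2 * k).factorial_ne_zero
  have hpow : (z / 2) ^ (2 * (k : ℂ) + ν) = z ^ (2 * k) / 4 ^ k * (z / 2) ^ ν := by
    rw [Complex.cpow_add _ _ (div_ne_zero hz two_ne_zero),
      show 2 * (k : ℂ) = ((2 * k : ℕ) : ℂ) by push_cast; ring, Complex.cpow_natCast, div_pow,
      pow_mul 2, show (2 : ℂ) ^ 2 = 4 by norm_num]
  have hfac := factorial_mul_Gamma_add_half k
  rw [hpow]
  generalize Complex.Gamma (ν + 1 / 2) = a at *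
  generalize Complex.Gamma (1 / 2) = b at *
  generalize Complex.Gamma ((k : ℂ) + 1 / 2) = c at *
  generalize (z / 2) ^ ν = p
  field_simp
  linear_combination (-p) * hfac

/-- Poisson's integral representation of the Bessel function. -/
theorem besselJ_eq_poissonIntegral {ν z : ℂ} (hν : -(1 / 2) < ν.re) (hz : z ≠ 0) :
    besselJ ν z = (z / 2) ^ ν / (Complex.Gamma (1 / 2) * Complex.Gamma (ν + 1 / 2)) *
      poissonIntegral ν z :=
  (hasSum_besselJ hν hz).tsum_eq

theorem besselPoissonKernel_zero_eq_norm {s : ℝ} (hs : s ∈ Ioc (0 : ℝ) 1) :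
    besselPoissonKernel 0 s = (‖besselPoissonKernel 0 s‖ : ℝ) := by
  have h : besselPoissonKernel 0 s = ((s ^ (-(1 / 2) : ℝ) * (1 - s) ^ (-(1 / 2) : ℝ) : ℝ) : ℂ) := by
    rw [Complex.ofReal_mul, Complex.ofReal_cpow hs.1.le,
      Complex.ofReal_cpow (sub_nonneg.mpr hs.2), besselPoissonKernel]
    norm_num
  rw [h, Complex.norm_real, Real.norm_of_nonneg]
  exact mul_nonneg (Real.rpow_nonneg hs.1.le _) (Real.rpow_nonneg (sub_nonneg.mpr hs.2) _)

theorem norm_besselPoissonKernel {ν : ℂ} (hν : ν.re = 0) {s : ℝ} (hs : s ∈ Ioc (0 : ℝ) 1) :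
    ‖besselPoissonKernel ν s‖ = ‖besselPoissonKernel 0 s‖ := by
  rw [besselPoissonKernel, besselPoissonKernel, norm_mul, norm_mul]
  congr 1
  rcases hs.2.lt_or_eq with h | rfl
  · rw [← Complex.ofReal_one, ← Complex.ofReal_sub,
      Complex.norm_cpow_eq_rpow_re_of_pos (sub_pos.mpr h),
      Complex.norm_cpow_eq_rpow_re_of_pos (sub_pos.mpr h)]
    simp [hν]
  · have h : ν + 1 / 2 - 1 ≠ 0 := fun h => by
      have := congrArg Complex.re h
      norm_num [hν] at this
    rw [Complex.ofReal_one, sub_self, Complex.zero_cpow h, Complex.zero_cpow (by norm_num)]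

theorem Gamma_one_half_mul_self :
    Complex.Gamma (1 / 2) * Complex.Gamma (1 / 2) = (π : ℂ) := by
  have h := Complex.Gamma_mul_Gamma_one_sub (1 / 2)
  rw [show (1 : ℂ) - 1 / 2 = 1 / 2 by norm_num, show (π : ℂ) * (1 / 2) = π / 2 by ring,
    Complex.sin_pi_div_two, div_one] at h
  exact h

theorem integral_norm_besselPoissonKernel_zero :
    ∫ s in (0 : ℝ)..1, ‖besselPoissonKernel 0 s‖ = π := by
  have h := integral_pow_mul_besselPoissonKernel (ν := 0) (by norm_num) 0
  simp only [pow_zero, one_mul, Nat.cast_zero, zero_add, Complex.Gamma_one, div_one,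
    Gamma_one_half_mul_self] at h
  rw [← Complex.ofReal_inj, ← h, ← intervalIntegral.integral_ofReal]
  refine intervalIntegral.integral_congr_ae (Filter.Eventually.of_forall fun s hs => ?_)
  rw [uIoc_of_le zero_le_one] at hs
  exact (besselPoissonKernel_zero_eq_norm hs).symm

theorem norm_cos_ofReal_mul_le (y s : ℝ) :
    ‖Complex.cos ((y : ℂ) * (√s : ℝ))‖ ≤ 1 := by
  rw [← Complex.ofReal_mul, ← Complex.ofReal_cos, Complex.norm_real]
  exact Real.abs_cos_le_one _

theorem norm_poissonIntegral_le {ν : ℂ} (hν : ν.re = 0) (y : ℝ) :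
    ‖poissonIntegral ν y‖ ≤ π := by
  rw [← integral_norm_besselPoissonKernel_zero]
  refine intervalIntegral.norm_integral_le_of_norm_le zero_le_one
    (Filter.Eventually.of_forall fun s hs => ?_)
    (intervalIntegrable_besselPoissonKernel (by norm_num)).norm
  rw [norm_mul, ← norm_besselPoissonKernel hν hs]
  exact mul_le_of_le_one_left (norm_nonneg _) (norm_cos_ofReal_mul_le y s)

theorem continuous_poissonIntegral_ofReal {ν : ℂ} (hν : -(1 / 2) < ν.re) :
    Continuous fun y : ℝ => poissonIntegral ν y := by
  have hK := intervalIntegrable_besselPoissonKernel hν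
  refine intervalIntegral.continuous_of_dominated_interval
    (bound := fun s => ‖besselPoissonKernel ν s‖) (fun y => ?_) (fun y => ?_) hK.norm ?_
  · have : Continuous fun s : ℝ => Complex.cos ((y : ℂ) * (√s : ℝ)) := by fun_prop
    exact this.aestronglyMeasurable.mul hK.aestronglyMeasurable_restrict_uIoc
  · refine Filter.Eventually.of_forall fun s _ => ?_
    rw [norm_mul]
    exact mul_le_of_le_one_left (norm_nonneg _) (norm_cos_ofReal_mul_le y s)
  · exact Filter.Eventually.of_forall fun s _ => by fun_prop

theorem norm_Gamma_I_mul_add_half_sq (τ : ℝ) :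
    ‖Complex.Gamma (Complex.I * τ + 1 / 2)‖ ^ 2 = π / Real.cosh (π * τ) := by
  have h := Complex.Gamma_mul_Gamma_one_sub (Complex.I * τ + 1 / 2)
  have hconj : 1 - (Complex.I * τ + 1 / 2) = (starRingEnd ℂ) (Complex.I * τ + 1 / 2) := by
    apply Complex.ext <;> norm_num
  rw [hconj, Complex.Gamma_conj, Complex.mul_conj, Complex.normSq_eq_norm_sq,
    show (π : ℂ) * (Complex.I * τ + 1 / 2) = ((π * τ : ℝ) : ℂ) * Complex.I + π / 2 by
      push_cast; ring,
    Complex.sin_add_pi_div_two, Complex.cos_mul_I, ← Complex.ofReal_cosh,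
    ← Complex.ofReal_div] at h
  exact Complex.ofReal_injective h

theorem norm_besselJ_sq_le (τ : ℝ) {y : ℝ} (hy : 0 < y) :
    ‖besselJ (Complex.I * τ) y‖ ^ 2 ≤ Real.cosh (π * τ) := by
  have hre : (Complex.I * (τ : ℂ)).re = 0 := by simp
  have hc := Real.cosh_pos (π * τ)
  have hG : ‖Complex.Gamma (1 / 2)‖ ^ 2 = π := by
    rw [sq, ← norm_mul, Gamma_one_half_mul_self, Complex.norm_real,
      Real.norm_of_nonneg Real.pi_pos.le]
  have hpow : ‖((y : ℂ) / 2) ^ (Complex.I * (τ : ℂ))‖ = 1 := by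
    rw [show (y : ℂ) / 2 = ((y / 2 : ℝ) : ℂ) by push_cast; rfl,
      Complex.norm_cpow_eq_rpow_re_of_pos (half_pos hy), hre, Real.rpow_zero]
  rw [besselJ_eq_poissonIntegral (by rw [hre]; norm_num) (Complex.ofReal_ne_zero.mpr hy.ne'),
    norm_mul, norm_div, norm_mul, hpow, mul_pow, div_pow, mul_pow, hG,
    norm_Gamma_I_mul_add_half_sq]
  have hP := pow_le_pow_left₀ (norm_nonneg _) (norm_poissonIntegral_le hre y) 2
  calc 1 ^ 2 / (π * (π / Real.cosh (π * τ))) * ‖poissonIntegral (Complex.I * τ) y‖ ^ 2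
      ≤ 1 ^ 2 / (π * (π / Real.cosh (π * τ))) * π ^ 2 := by gcongr
    _ = Real.cosh (π * τ) := by field_simp

theorem continuousOn_besselJ_ofReal {ν : ℂ} (hν : -(1 / 2) < ν.re) :
    ContinuousOn (fun y : ℝ => besselJ ν y) (Ioi 0) := by
  have hpow : ContinuousOn (fun y : ℝ => ((y : ℂ) / 2) ^ ν) (Ioi 0) := by
    refine ContinuousOn.cpow_const (by fun_prop) fun y hy => ?_
    rw [show (y : ℂ) / 2 = ((y / 2 : ℝ) : ℂ) by push_cast; rfl]
    exact Complex.ofReal_mem_slitPlane.mpr (half_pos hy)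
  refine ((hpow.div_const (Complex.Gamma (1 / 2) * Complex.Gamma (ν + 1 / 2))).mul
    (continuous_poissonIntegral_ofReal hν).continuousOn).congr fun y hy => ?_
  exact besselJ_eq_poissonIntegral hν (Complex.ofReal_ne_zero.mpr (ne_of_gt hy))

theorem stronglyMeasurable_besselJ_I_mul {z : ℂ} (hz : z ≠ 0) :
    StronglyMeasurable fun τ : ℝ => besselJ (Complex.I * τ) z := by
  refine stronglyMeasurable_of_tendsto Filter.atTop
    (f := fun (s : Finset ℕ) (τ : ℝ) => ∑ k ∈ s,
      ((-1 : ℂ) ^ k * (z / 2) ^ (2 * (k : ℂ) + Complex.I * τ)) /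
        ((k.factorial : ℂ) * Complex.Gamma ((k : ℂ) + Complex.I * τ + 1))) (fun s => ?_)
    (tendsto_pi_nhds.mpr fun τ => ?_)
  · refine Continuous.stronglyMeasurable (continuous_finsetSum _ fun k _ => ?_)
    simp only [div_eq_mul_inv _ ((k.factorial : ℂ) * _), mul_inv]
    have hG : Continuous fun τ : ℝ => (Complex.Gamma ((k : ℂ) + Complex.I * τ + 1))⁻¹ :=
      Complex.differentiable_one_div_Gamma.continuous.comp (by fun_prop)
    have hp : Continuous fun τ : ℝ => (z / 2) ^ (2 * (k : ℂ) + Complex.I * τ) :=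
      Continuous.const_cpow (by fun_prop) (Or.inl (div_ne_zero hz two_ne_zero))
    exact (continuous_const.mul hp).mul (continuous_const.mul hG)
  · have h := hasSum_besselJ (ν := Complex.I * τ) (by simp) hz
    rw [← besselJ_eq_poissonIntegral (by simp) hz] at h
    exact h

theorem norm_indexG_integrand_le (g : ℝ → ℂ) {x : ℝ} (hx : 0 < x) (τ : ℝ) :
    ‖((((besselJ (Complex.I * τ) (Real.sqrt x : ℂ)) ^ 2).re : ℝ) : ℂ) * g τ /
      ((Real.cosh (π * τ) : ℝ) : ℂ)‖ ≤ ‖g τ‖ := by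
  have hc := Real.cosh_pos (π * τ)
  rw [norm_div, norm_mul, Complex.norm_real, Complex.norm_real, Real.norm_of_nonneg hc.le,
    div_le_iff₀ hc, mul_comm]
  gcongr
  calc ‖((besselJ (Complex.I * τ) (Real.sqrt x : ℂ)) ^ 2).re‖
      ≤ ‖(besselJ (Complex.I * τ) (Real.sqrt x : ℂ)) ^ 2‖ := Complex.abs_re_le_norm _
    _ = ‖besselJ (Complex.I * τ) (Real.sqrt x : ℂ)‖ ^ 2 := norm_pow _ _
    _ ≤ Real.cosh (π * τ) := norm_besselJ_sq_le τ (Real.sqrt_pos.mpr hx)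

theorem aestronglyMeasurable_indexG_integrand {g : ℝ → ℂ} (hg : Integrable g) {x : ℝ}
    (hx : 0 < x) :
    AEStronglyMeasurable fun τ : ℝ =>
      ((((besselJ (Complex.I * τ) (Real.sqrt x : ℂ)) ^ 2).re : ℝ) : ℂ) * g τ /
        ((Real.cosh (π * τ) : ℝ) : ℂ) := by
  have hJ := stronglyMeasurable_besselJ_I_mul
    (Complex.ofReal_ne_zero.mpr (Real.sqrt_pos.mpr hx).ne')
  have hre : StronglyMeasurable fun τ : ℝ =>
      ((((besselJ (Complex.I * τ) (Real.sqrt x : ℂ)) ^ 2).re : ℝ) : ℂ) :=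
    (Complex.continuous_ofReal.comp Complex.continuous_re).comp_stronglyMeasurable (hJ.pow 2)
  have hcosh : Continuous fun τ : ℝ => (((Real.cosh (π * τ) : ℝ) : ℂ))⁻¹ := by
    refine Continuous.inv₀ ?_ fun τ => Complex.ofReal_ne_zero.mpr (Real.cosh_pos _).ne'
    exact Complex.continuous_ofReal.comp (Real.continuous_cosh.comp (by fun_prop))
  simp only [div_eq_mul_inv]
  exact (hre.aestronglyMeasurable.mul hg.aestronglyMeasurable).mul hcosh.aestronglyMeasurable

/-- (Theorem 3, boundedness part) If `g ∈ L_1(ℝ)`, then `Gg` is well defined, bounded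
and continuous on `(0,∞)`, with `sup_{x>0} |(Gg)(x)| ≤ √π ∫_{−∞}^∞ |g(τ)| dτ`. -/
theorem indexG_bounded_continuous (g : ℝ → ℂ) (hg : MeasureTheory.Integrable g) :
    (∀ x : ℝ, 0 < x → MeasureTheory.Integrable (fun τ : ℝ =>
      ((((besselJ (Complex.I * τ) (Real.sqrt x : ℂ)) ^ 2).re : ℝ) : ℂ) * g τ /
        ((Real.cosh (π * τ) : ℝ) : ℂ))) ∧
    ContinuousOn (indexG g) (Set.Ioi 0) ∧
    (∀ x : ℝ, 0 < x → ‖indexG g x‖ ≤ Real.sqrt π * ∫ τ : ℝ, ‖g τ‖) := by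
  refine ⟨fun x hx => hg.mono (aestronglyMeasurable_indexG_integrand hg hx)
    (Filter.Eventually.of_forall (norm_indexG_integrand_le g hx)), ?_, fun x hx => ?_⟩
  · refine continuousOn_const.mul (continuousOn_of_dominated (bound := fun τ => ‖g τ‖)
      (fun x hx => aestronglyMeasurable_indexG_integrand hg hx)
      (fun x hx => Filter.Eventually.of_forall (norm_indexG_integrand_le g hx)) hg.norm
      (Filter.Eventually.of_forall fun τ => ?_))
    have hJ : ContinuousOn (fun x : ℝ => besselJ (Complex.I * τ) (Real.sqrt x : ℂ)) (Ioi 0) :=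
      (continuousOn_besselJ_ofReal (by simp)).comp Real.continuous_sqrt.continuousOn
        fun x hx => Real.sqrt_pos.mpr hx
    exact (((Complex.continuous_ofReal.comp Complex.continuous_re).comp_continuousOn
      (hJ.pow 2)).mul continuousOn_const).div_const _
  · rw [indexG, norm_mul, Complex.norm_real, Real.norm_of_nonneg (Real.sqrt_nonneg π)]
    gcongr
    exact norm_integral_le_of_norm_le hg.norm
      (Filter.Eventually.of_forall (norm_indexG_integrand_le g hx))
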